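/- arXiv:0710.4078 — 5 statements merged into one kernel-verified Lean document; each statement's English description precedes it below -/
import Mathlib

section
/- Let m ≥ 1 and let M be a real symmetric negative definite m×m matrix whose off-diagonal entries are all nonnegative (M i j ≥ 0 for i ≠ j). Then there exists a vector q ∈ ℝ^m with q_i > 0 for every i such that (M q)_i < 0 for every i. -/
open Matrix

/-- A matrix with nonnegative off-diagonal entries pairs nonnegative vectors with disjoint
supports to a nonnegative number. -/
theorem Matrix.dotProduct_mulVec_nonneg_of_mul_eq_zero {n : Type*} [Fintype n]
    {M : Matrix n n ℝ} (hoff : ∀ i j, i ≠ j → 0 ≤ M i j) {u v : n → ℝ}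
    (hu : 0 ≤ u) (hv : 0 ≤ v) (huv : ∀ i, u i * v i = 0) :
    0 ≤ u ⬝ᵥ M *ᵥ v := by
  simp only [dotProduct, mulVec, Finset.mul_sum]
  refine Finset.sum_nonneg fun i _ => Finset.sum_nonneg fun j _ => ?_
  rcases eq_or_ne i j with rfl | hij
  · rw [mul_left_comm, huv, mul_zero]
  · exact mul_nonneg (hu i) (mul_nonneg (hoff i j hij) (hv j))

/-- A negative definite real matrix is surjective as a linear map. -/
theorem Matrix.mulVec_surjective_of_neg_definite {n : Type*} [Fintype n]
    {M : Matrix n n ℝ} (hneg : ∀ x : n → ℝ, x ≠ 0 → x ⬝ᵥ M *ᵥ x < 0) :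
    Function.Surjective M.mulVec := by
  have hinj : Function.Injective M.mulVecLin := by
    refine (injective_iff_map_eq_zero _).2 fun x hx => ?_
    by_contra hne
    have h := hneg x hne
    rw [← mulVecLin_apply, hx, dotProduct_zero] at h
    exact h.false
  exact LinearMap.injective_iff_surjective.1 hinj

/-- If `M` is a real negative definite matrix with nonnegative off-diagonal entries and all
entries of `M q` are negative, then all entries of `q` are positive. -/
theorem Matrix.pos_of_mulVec_neg {n : Type*} [Fintype n] {M : Matrix n n ℝ}
    (hneg : ∀ x : n → ℝ, x ≠ 0 → x ⬝ᵥ M *ᵥ x < 0)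
    (hoff : ∀ i j, i ≠ j → 0 ≤ M i j) {q : n → ℝ} (hq : ∀ i, (M *ᵥ q) i < 0) (i : n) :
    0 < q i := by
  classical
  have hminus : q⁻ = 0 := by
    by_contra hne
    have h₁ := hneg _ hne
    have h₂ : 0 ≤ q⁻ ⬝ᵥ M *ᵥ q⁺ :=
      dotProduct_mulVec_nonneg_of_mul_eq_zero hoff (negPart_nonneg q) (posPart_nonneg q) fun i => by
        rcases le_total (q i) 0 with h | h <;> simp [h]
    have h₃ : q⁻ ⬝ᵥ M *ᵥ q ≤ 0 :=
      Finset.sum_nonpos fun i _ =>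
        mul_nonpos_of_nonneg_of_nonpos (negPart_nonneg q i) (hq i).le
    have h₄ : q⁻ ⬝ᵥ M *ᵥ q = q⁻ ⬝ᵥ M *ᵥ q⁺ - q⁻ ⬝ᵥ M *ᵥ q⁻ := by
      rw [← dotProduct_sub, ← mulVec_sub, posPart_sub_negPart]
    linarith
  have hnonneg : 0 ≤ q := negPart_eq_zero.1 hminus
  refine (hnonneg i).lt_of_ne' fun hi => (hq i).not_ge ?_
  rw [← single_one_dotProduct i (M *ᵥ q)]
  refine dotProduct_mulVec_nonneg_of_mul_eq_zero hoff
    (Pi.single_nonneg.2 zero_le_one) hnonneg fun j => ?_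
  rcases eq_or_ne j i with rfl | hj
  · rw [hi, Pi.zero_apply, mul_zero]
  · rw [Pi.single_eq_of_ne hj, zero_mul]

/-- If `M` is a real symmetric negative definite `m × m` matrix (`m ≥ 1`) with nonnegative
off-diagonal entries, then there exists a vector `q` with all entries positive such that
`(M q)ᵢ < 0` for all `i`. -/
theorem stmt_1 (m : ℕ) (hm : 1 ≤ m) (M : Matrix (Fin m) (Fin m) ℝ)
    (hsymm : M.IsSymm)
    (hnegdef : ∀ x : Fin m → ℝ, x ≠ 0 → x ⬝ᵥ M.mulVec x < 0)
    (hoff : ∀ i j : Fin m, i ≠ j → 0 ≤ M i j) :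
    ∃ q : Fin m → ℝ, (∀ i, 0 < q i) ∧ (∀ i, M.mulVec q i < 0) := by
  obtain ⟨q, hq⟩ := mulVec_surjective_of_neg_definite hnegdef (fun _ => -1)
  have hlt : ∀ i, (M *ᵥ q) i < 0 := fun i => by
    rw [hq]
    exact neg_one_lt_zero
  exact ⟨q, pos_of_mulVec_neg hnegdef hoff hlt, hlt⟩
end

section
/- Let m ≥ 1 and let M be a real m×m matrix whose off-diagonal entries are all nonnegative (M i j ≥ 0 for i ≠ j). If d, d' ∈ ℝ^m satisfy (M d)_i ≤ 0 and (M d')_i ≤ 0 for every index i, then the componentwise minimum e, defined by e_i = min(d_i, d'_i), also satisfies (M e)_i ≤ 0 for every index i. -/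
/-- If row `i` of `M` is nonnegative off the diagonal, then `(M *ᵥ ·) i` is monotone among vectors
with the same `i`-th coordinate. -/
theorem Matrix.mulVec_apply_le_of_offDiag_nonneg {n : Type*} [Fintype n] {M : Matrix n n ℝ} {i : n}
    (hM : ∀ j, i ≠ j → 0 ≤ M i j) {v w : n → ℝ} (hvw : v ≤ w) (hi : v i = w i) :
    M.mulVec v i ≤ M.mulVec w i := by
  refine Finset.sum_le_sum fun j _ => ?_
  obtain rfl | hij := eq_or_ne i j
  · rw [hi]
  · exact mul_le_mul_of_nonneg_left (hvw j) (hM j hij)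

/-- If `M` is a real `m × m` matrix (`m ≥ 1`) with nonnegative off-diagonal entries, and
`d`, `d'` are vectors with `(M d)ᵢ ≤ 0` and `(M d')ᵢ ≤ 0` for all `i`, then the
componentwise minimum `e` of `d` and `d'` also satisfies `(M e)ᵢ ≤ 0` for all `i`. -/
theorem stmt_2 (m : ℕ) (hm : 1 ≤ m) (M : Matrix (Fin m) (Fin m) ℝ)
    (hoff : ∀ i j : Fin m, i ≠ j → 0 ≤ M i j)
    (d d' : Fin m → ℝ)
    (hd : ∀ i, M.mulVec d i ≤ 0) (hd' : ∀ i, M.mulVec d' i ≤ 0) :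
    ∀ i, M.mulVec (fun i => min (d i) (d' i)) i ≤ 0 := by
  intro i
  rcases le_total (d i) (d' i) with h | h
  · exact (Matrix.mulVec_apply_le_of_offDiag_nonneg (hoff i) (fun j => min_le_left _ _)
      (min_eq_left h)).trans (hd i)
  · exact (Matrix.mulVec_apply_le_of_offDiag_nonneg (hoff i) (fun j => min_le_right _ _)
      (min_eq_right h)).trans (hd' i)
end

section
/- Fix an integer n ≥ 1 and let B be the bilinear form on ℝ^{n+1} given by B(u,v) = u₀v₀ − Σ_{i=1}^{n} uᵢvᵢ. Let K, L, D ∈ ℝ^{n+1} satisfy B(L,L) > 0, B(L,D) > 0, B(D,D) ≥ 0, B(K,L) ≥ 0, and assume that either B(K,D) ≤ 0 or 4·B(K,D) + B(K,K) ≥ 0. Then the polynomial t ↦ B(L − tD, L − tD) has a positive real root; moreover, if ε denotes its smallest positive root, then 2ε(3B(L,D) − εB(D,D)) > 0 and −B(K,L)/B(L,L) ≤ 3(2B(L,D) − ε(B(K,D) + B(D,D))) / (2ε(3B(L,D) − εB(D,D))). -/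
/-- The Minkowski bilinear form on `ℝ^{n+1}`: `B u v = u₀v₀ - ∑_{i=1}^n uᵢvᵢ`. -/
def minkB (n : ℕ) (u v : Fin (n + 1) → ℝ) : ℝ :=
  u 0 * v 0 - ∑ i : Fin n, u i.succ * v i.succ

theorem minkB_comm (n : ℕ) (u v : Fin (n + 1) → ℝ) : minkB n u v = minkB n v u := by
  simp only [minkB, mul_comm]

theorem minkB_smul_left (n : ℕ) (c : ℝ) (u v : Fin (n + 1) → ℝ) :
    minkB n (c • u) v = c * minkB n u v := by
  simp only [minkB, Pi.smul_apply, smul_eq_mul, mul_assoc, ← Finset.mul_sum]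
  ring

theorem minkB_sub_left (n : ℕ) (u v w : Fin (n + 1) → ℝ) :
    minkB n (u - v) w = minkB n u w - minkB n v w := by
  simp only [minkB, Pi.sub_apply, sub_mul, Finset.sum_sub_distrib]
  ring

theorem minkB_sub_smul_self (n : ℕ) (u v : Fin (n + 1) → ℝ) (t : ℝ) :
    minkB n (u - t • v) (u - t • v) =
      minkB n u u - 2 * t * minkB n u v + t ^ 2 * minkB n v v := by
  rw [minkB_sub_left, minkB_smul_left, minkB_comm n u, minkB_comm n v, minkB_sub_left,
    minkB_sub_left, minkB_smul_left, minkB_smul_left, minkB_comm n v u]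
  ring

/-- Two causal vectors whose time coordinates have weakly equal signs pair non-negatively. -/
theorem minkB_nonneg_of_mul_nonneg {n : ℕ} {u v : Fin (n + 1) → ℝ} (hu : 0 ≤ minkB n u u)
    (hv : 0 ≤ minkB n v v) (h : 0 ≤ u 0 * v 0) : 0 ≤ minkB n u v := by
  have hcs := Finset.sum_mul_sq_le_sq_mul_sq Finset.univ
    (fun i : Fin n => u i.succ) (fun i => v i.succ)
  simp only [minkB, ← pow_two] at hu hv ⊢
  have hprod := mul_le_mul (sub_nonneg.mp hu) (sub_nonneg.mp hv)
    (Finset.sum_nonneg fun i _ => sq_nonneg _) (sq_nonneg _)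
  exact sub_nonneg.mpr (abs_le_of_sq_le_sq' (by nlinarith) h).2

/-- If a causal vector pairs non-negatively with a timelike one, their time coordinates have
weakly equal signs. -/
theorem mul_nonneg_of_minkB_nonneg {n : ℕ} {u v : Fin (n + 1) → ℝ} (hu : 0 ≤ minkB n u u)
    (hv : 0 < minkB n v v) (h : 0 ≤ minkB n u v) : 0 ≤ u 0 * v 0 := by
  by_contra! hneg
  have hcs := Finset.sum_mul_sq_le_sq_mul_sq Finset.univ
    (fun i : Fin n => u i.succ) (fun i => v i.succ)
  simp only [minkB, ← pow_two] at hu hv h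
  have hu0 : 0 < u 0 ^ 2 := by
    have : u 0 ≠ 0 := fun h0 => by simp [h0] at hneg
    positivity
  have hV : 0 ≤ ∑ i : Fin n, v i.succ ^ 2 := Finset.sum_nonneg fun i _ => sq_nonneg _
  have h1 := mul_le_mul_of_nonneg_right (sub_nonneg.mp hu) hV
  have h2 := mul_lt_mul_of_pos_left (sub_pos.mp hv) hu0
  nlinarith

theorem time_ne_zero_of_minkB_pos {n : ℕ} {u : Fin (n + 1) → ℝ} (hu : 0 < minkB n u u) :
    u 0 ≠ 0 := by
  intro h
  have : 0 ≤ ∑ i : Fin n, u i.succ * u i.succ := Finset.sum_nonneg fun i _ => mul_self_nonneg _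
  simp only [minkB, h] at hu
  linarith

/-- Causal vectors in the closed cone of a timelike vector pair non-negatively. -/
theorem minkB_nonneg_of_timelike {n : ℕ} {u v w : Fin (n + 1) → ℝ} (hu : 0 ≤ minkB n u u)
    (hv : 0 ≤ minkB n v v) (hw : 0 < minkB n w w) (huw : 0 ≤ minkB n u w)
    (hvw : 0 ≤ minkB n v w) : 0 ≤ minkB n u v := by
  refine minkB_nonneg_of_mul_nonneg hu hv ?_
  have hw0 := time_ne_zero_of_minkB_pos hw
  have hprod := mul_nonneg (mul_nonneg_of_minkB_nonneg hu hw huw)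
    (mul_nonneg_of_minkB_nonneg hv hw hvw)
  refine nonneg_of_mul_nonneg_left (b := w 0 ^ 2) ?_ (by positivity)
  linarith

/-- A line in a causal direction `D` through a timelike vector `L` with `B(L,D) > 0` meets the
null cone at a positive parameter. -/
theorem exists_pos_minkB_sub_smul_eq_zero {n : ℕ} {L D : Fin (n + 1) → ℝ}
    (hLL : 0 < minkB n L L) (hLD : 0 < minkB n L D) (hDD : 0 ≤ minkB n D D) :
    ∃ t : ℝ, 0 < t ∧ minkB n (L - t • D) (L - t • D) = 0 := by
  have hD0 : D 0 ≠ 0 := by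
    intro h
    have hneg : minkB n ((-1 : ℝ) • L) ((-1 : ℝ) • L) = minkB n L L := by
      rw [minkB_smul_left, minkB_comm, minkB_smul_left]
      ring
    have := minkB_nonneg_of_mul_nonneg (u := (-1 : ℝ) • L) (hneg ▸ hLL.le) hDD (by simp [h])
    rw [minkB_smul_left] at this
    linarith
  have hsign := mul_nonneg_of_minkB_nonneg hDD hLL (by rw [minkB_comm]; exact hLD.le)
  set s := L 0 / D 0 with hs
  have hs0 : 0 ≤ s := by
    have : s = D 0 * L 0 / D 0 ^ 2 := by rw [hs]; field_simp
    rw [this]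
    positivity
  have hend : minkB n (L - s • D) (L - s • D) ≤ 0 := by
    have h0 : (L - s • D) 0 = 0 := by simp [hs, hD0]
    have : 0 ≤ ∑ i : Fin n, (L - s • D) i.succ * (L - s • D) i.succ :=
      Finset.sum_nonneg fun i _ => mul_self_nonneg _
    unfold minkB
    rw [h0]
    linarith
  have hcont : Continuous fun t : ℝ => minkB n (L - t • D) (L - t • D) := by
    simp only [minkB_sub_smul_self]
    fun_prop
  obtain ⟨t, ht, hroot⟩ := intermediate_value_Icc' hs0 hcont.continuousOn
    ⟨hend, by simpa using hLL.le⟩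
  refine ⟨t, ht.1.lt_of_ne ?_, hroot⟩
  rintro rfl
  simp only [zero_smul, sub_zero] at hroot
  exact hLL.ne' hroot

/-- The least positive root of `t ↦ B(L - tD, L - tD)` lies weakly left of its critical point. -/
theorem mul_minkB_le_of_isLeast {n : ℕ} {L D : Fin (n + 1) → ℝ} {ε : ℝ}
    (hLL : 0 < minkB n L L) (hLD : 0 < minkB n L D) (hDD : 0 ≤ minkB n D D)
    (hε : IsLeast {t : ℝ | 0 < t ∧ minkB n (L - t • D) (L - t • D) = 0} ε) :
    ε * minkB n D D ≤ minkB n L D := by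
  obtain ⟨⟨hε0, hroot⟩, hmin⟩ := hε
  rw [minkB_sub_smul_self] at hroot
  rcases hDD.eq_or_lt with hd | hd
  · rw [← hd, mul_zero]
    exact hLD.le
  have hconj : 2 * minkB n L D / minkB n D D - ε = minkB n L L / (ε * minkB n D D) := by
    field_simp
    linarith
  have hle : ε ≤ 2 * minkB n L D / minkB n D D - ε := by
    refine hmin ⟨by rw [hconj]; positivity, ?_⟩
    rw [minkB_sub_smul_self]
    field_simp
    linear_combination minkB n D D * hroot
  have := (le_div_iff₀ hd).mp (show 2 * ε ≤ 2 * minkB n L D / minkB n D D by linarith)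
  linarith

/-- The slope inequality `μ(X,L) ≤ μ_{ε̃}(O_D,L)` in the hyperbolic model of the
Néron–Severi space: under the stated sign conditions on `B(L,L)`, `B(L,D)`, `B(D,D)`,
`B(K,L)` and the alternative `B(K,D) ≤ 0` or `4B(K,D) + B(K,K) ≥ 0`, the polynomial
`t ↦ B(L - tD, L - tD)` has a positive root, and its smallest positive root `ε` satisfies
`2ε(3B(L,D) − εB(D,D)) > 0` and
`−B(K,L)/B(L,L) ≤ 3(2B(L,D) − ε(B(K,D)+B(D,D))) / (2ε(3B(L,D) − εB(D,D)))`. -/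
theorem stmt_6 (n : ℕ) (hn : 1 ≤ n) (K L D : Fin (n + 1) → ℝ)
    (hLL : 0 < minkB n L L) (hLD : 0 < minkB n L D) (hDD : 0 ≤ minkB n D D)
    (hKL : 0 ≤ minkB n K L)
    (hK : minkB n K D ≤ 0 ∨ 0 ≤ 4 * minkB n K D + minkB n K K) :
    (∃ t : ℝ, 0 < t ∧ minkB n (L - t • D) (L - t • D) = 0) ∧
    ∀ ε : ℝ, IsLeast {t : ℝ | 0 < t ∧ minkB n (L - t • D) (L - t • D) = 0} ε →
      0 < 2 * ε * (3 * minkB n L D - ε * minkB n D D) ∧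
      -minkB n K L / minkB n L L ≤
        3 * (2 * minkB n L D - ε * (minkB n K D + minkB n D D)) /
          (2 * ε * (3 * minkB n L D - ε * minkB n D D)) := by
  refine ⟨exists_pos_minkB_sub_smul_eq_zero hLL hLD hDD, fun ε hε => ?_⟩
  have hcrit := mul_minkB_le_of_isLeast hLL hLD hDD hε
  obtain ⟨hε0, hnull⟩ := hε.1
  have hroot := hnull
  rw [minkB_sub_smul_self] at hroot
  have hden : 0 < 2 * ε * (3 * minkB n L D - ε * minkB n D D) :=
    mul_pos (by positivity) (by linarith)
  refine ⟨hden, ?_⟩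
  rw [div_le_div_iff₀ hLL hden]
  have hleft : 0 ≤ minkB n K L * (2 * ε * (3 * minkB n L D - ε * minkB n D D)) :=
    mul_nonneg hKL hden.le
  rcases le_total (ε * minkB n K D) (2 * minkB n L D - ε * minkB n D D) with hx | hx
  · have := mul_nonneg (sub_nonneg.mpr hx) hLL.le
    linarith
  rcases hK with hK | hK
  · have := mul_nonneg hε0.le (neg_nonneg.mpr hK)
    linarith
  have hcone : 0 ≤ minkB n (K - (-2 : ℝ) • D) (L - ε • D) := by
    refine minkB_nonneg_of_timelike ?_ hnull.ge hLL ?_ ?_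
    · rw [minkB_sub_smul_self]
      linarith
    · rw [minkB_sub_left, minkB_smul_left, minkB_comm n D L]
      linarith
    · rw [minkB_sub_left, minkB_smul_left, minkB_comm n D L]
      have := mul_nonneg hε0.le (sub_nonneg.mpr hcrit)
      linarith
  rw [minkB_sub_left, minkB_smul_left, minkB_comm n K, minkB_comm n D, minkB_sub_left,
    minkB_sub_left, minkB_smul_left, minkB_smul_left, minkB_comm n L K, minkB_comm n D K] at hcone
  have hbound := mul_nonneg hcone hden.le
  have hrest : 0 ≤ ε * (ε * minkB n D D * (ε * minkB n K D +
      (4 * minkB n L D - ε * minkB n D D))) :=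
    mul_nonneg hε0.le (mul_nonneg (mul_nonneg hε0.le hDD) (by linarith))
  have hLLeq : minkB n L L = 2 * ε * minkB n L D - ε ^ 2 * minkB n D D := by linarith
  rw [hLLeq]
  linarith
end

section
/- Fix an integer n ≥ 1 and let B be the bilinear form on ℝ^{n+1} given by B(u,v) = u₀v₀ − Σ_{i=1}^{n} uᵢvᵢ. Let A, D, W ∈ ℝ^{n+1} satisfy B(A,A) > 0, B(A,D) ≥ 0, B(A,W) ≥ 0, B(D,D) ≥ 0 and B(W,W) ≥ 0. Then 2·B(W,A)·B(A,D) − (B(W,D) − 3·B(D,D))·B(A,A) ≥ 0. -/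
theorem minkB_smul_sub_smul_left (n : ℕ) (r s : ℝ) (u v w : Fin (n + 1) → ℝ) :
    minkB n (r • u - s • v) w = r * minkB n u w - s * minkB n v w := by
  simp only [minkB, Pi.sub_apply, Pi.smul_apply, smul_eq_mul, sub_mul, Finset.sum_sub_distrib,
    mul_assoc, ← Finset.mul_sum]
  ring

theorem minkB_smul_sub_smul_right (n : ℕ) (r s : ℝ) (u v w : Fin (n + 1) → ℝ) :
    minkB n w (r • u - s • v) = r * minkB n w u - s * minkB n w v := by
  simp only [minkB_comm n w, minkB_smul_sub_smul_left]

theorem minkB_zero_left (n : ℕ) (u : Fin (n + 1) → ℝ) : minkB n 0 u = 0 := by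
  simp [minkB]

/-- The form is negative definite on the orthogonal complement of a positive vector. -/
theorem eq_zero_of_minkB_eq_zero {n : ℕ} {A u : Fin (n + 1) → ℝ} (hA : 0 < minkB n A A)
    (hAu : minkB n A u = 0) (hu : 0 ≤ minkB n u u) : u = 0 := by
  have cauchy := Finset.sum_mul_sq_le_sq_mul_sq Finset.univ
    (fun i : Fin n => A i.succ) (fun i => u i.succ)
  have hS : 0 ≤ ∑ i : Fin n, A i.succ ^ 2 := Finset.sum_nonneg fun i _ => sq_nonneg _
  have hT : 0 ≤ ∑ i : Fin n, u i.succ ^ 2 := Finset.sum_nonneg fun i _ => sq_nonneg _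
  simp only [minkB, ← pow_two] at hA hAu hu
  rw [← sub_eq_zero.mp hAu] at cauchy
  have hu0 : u 0 = 0 := by
    by_contra h
    have hpos : 0 < u 0 ^ 2 := by positivity
    nlinarith [mul_le_mul_of_nonneg_left (sub_nonneg.mp hu) hS, mul_pos hA hpos]
  have hsum : ∑ i : Fin n, u i.succ ^ 2 = 0 := by
    rw [hu0] at hu
    linarith
  rw [Finset.sum_eq_zero_iff_of_nonneg fun i _ => sq_nonneg _] at hsum
  funext i
  refine Fin.cases hu0 (fun j => ?_) i
  simpa using hsum j (Finset.mem_univ j)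

/-- Two vectors of the closed cone determined by a positive vector pair nonnegatively. -/
theorem minkB_nonneg_of_cone {n : ℕ} {A X Y : Fin (n + 1) → ℝ} (hA : 0 < minkB n A A)
    (hAX : 0 ≤ minkB n A X) (hAY : 0 ≤ minkB n A Y)
    (hX : 0 ≤ minkB n X X) (hY : 0 ≤ minkB n Y Y) : 0 ≤ minkB n X Y := by
  rcases hAX.eq_or_lt with hAX0 | hAX0
  · rw [eq_zero_of_minkB_eq_zero hA hAX0.symm hX, minkB_zero_left]
  rcases hAY.eq_or_lt with hAY0 | hAY0
  · rw [eq_zero_of_minkB_eq_zero hA hAY0.symm hY, minkB_comm, minkB_zero_left]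
  by_contra! hXY
  have hu : 0 < minkB n (minkB n A Y • X - minkB n A X • Y)
      (minkB n A Y • X - minkB n A X • Y) := by
    simp only [minkB_smul_sub_smul_left, minkB_smul_sub_smul_right, minkB_comm n Y X]
    nlinarith [mul_pos (mul_pos hAX0 hAY0) (neg_pos.mpr hXY),
      mul_nonneg (sq_nonneg (minkB n A Y)) hX, mul_nonneg (sq_nonneg (minkB n A X)) hY]
  have h0 := eq_zero_of_minkB_eq_zero hA
    (by rw [minkB_smul_sub_smul_right]; ring) hu.le
  rw [h0, minkB_zero_left] at hu
  exact hu.false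

/-- Lemma 6.2 of the paper in the hyperbolic model: if `B(A,A) > 0`, `B(A,D) ≥ 0`,
`B(A,W) ≥ 0`, `B(D,D) ≥ 0` and `B(W,W) ≥ 0`, then
`2·B(W,A)·B(A,D) − (B(W,D) − 3·B(D,D))·B(A,A) ≥ 0`. -/
theorem stmt_7 (n : ℕ) (hn : 1 ≤ n) (A D W : Fin (n + 1) → ℝ)
    (hAA : 0 < minkB n A A) (hAD : 0 ≤ minkB n A D) (hAW : 0 ≤ minkB n A W)
    (hDD : 0 ≤ minkB n D D) (hWW : 0 ≤ minkB n W W) :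
    0 ≤ 2 * minkB n W A * minkB n A D - (minkB n W D - 3 * minkB n D D) * minkB n A A := by
  have key : 0 ≤ minkB n ((2 * minkB n A W) • A - minkB n A A • W) D := by
    refine minkB_nonneg_of_cone hAA ?_ hAD ?_ hDD
    · rw [minkB_smul_sub_smul_right]
      linarith [mul_nonneg hAA.le hAW]
    · simp only [minkB_smul_sub_smul_left, minkB_smul_sub_smul_right, minkB_comm n W A]
      linarith [mul_nonneg (sq_nonneg (minkB n A A)) hWW]
  rw [minkB_smul_sub_smul_left] at key
  rw [minkB_comm n W A]
  linarith [mul_nonneg hDD hAA.le]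
end

section
/- Let c, l2, ld, kl, kd, dd be real numbers with c > 0, l2 > 0, ld > 0, dd ≤ 0, kd ≥ 0 and 2·kl·ld − l2·kd ≥ 0. Then 3·(2·ld − c·kd − c·dd) / (2·c·(3·ld − c·dd)) > −kl/l2. -/
/-- The slope computation of Example 5.7: if `c > 0`, `L² > 0`, `L.D > 0`, `D² ≤ 0`,
`K.D ≥ 0` and `2(K.L)(L.D) − L²(K.D) ≥ 0`, then
`3(2L.D − c·K.D − c·D²)/(2c(3L.D − c·D²)) > −K.L/L²`. -/
theorem stmt_15 (c l2 ld kl kd dd : ℝ) (hc : 0 < c) (hl2 : 0 < l2) (hld : 0 < ld)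
    (hdd : dd ≤ 0) (hkd : 0 ≤ kd) (h : 0 ≤ 2 * kl * ld - l2 * kd) :
    3 * (2 * ld - c * kd - c * dd) / (2 * c * (3 * ld - c * dd)) > -kl / l2 := by
  have hkl : 0 ≤ kl := by
    by_contra! hneg
    nlinarith [mul_pos (neg_pos.mpr hneg) hld, mul_nonneg hl2.le hkd]
  have hcdd : 0 ≤ c * -dd := mul_nonneg hc.le (neg_nonneg.mpr hdd)
  have hden : 0 < 2 * c * (3 * ld - c * dd) := mul_pos (by linarith) (by linarith)
  rw [gt_iff_lt, div_lt_div_iff₀ hl2 hden]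
  linarith [mul_pos hld hl2, mul_nonneg hc.le h, mul_nonneg hcdd hl2.le,
    mul_nonneg (mul_nonneg hc.le hkl) hcdd]
end
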